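/- Let F be the fermionic Fock space of the bc-system, with operators b(n), c(n) and the modes W̃_m defined in the context. Then for all m, n ∈ ℤ, as operators on F: W̃_m ∘ b(n) − b(n) ∘ W̃_m = (1/2)(m + n)(m + 2n)·b(m+n) and W̃_m ∘ c(n) − c(n) ∘ W̃_m = −(1/2)·n·(m + 2n)·c(m+n). (These are the mode forms of the operator product expansions W̃(z)b(w) ∼ (1/2)∂b(w)/(z−w)² + ∂²b(w)/(z−w) and W̃(z)c(w) ∼ −c(w)/(z−w)³ − (3/2)∂c(w)/(z−w)² − ∂²c(w)/(z−w).) -/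

import Mathlib

noncomputable section

open ExteriorAlgebra

/-- Index type for the basis of `V`: `Sum.inl n` corresponds to `v_n` (`n ≥ 0`),
and `Sum.inr n` corresponds to `w_{n+1}` (so the `w_k` for `k ≥ 1`). -/
abbrev BCIndex : Type := ℕ ⊕ ℕ

/-- The vector space `V` with basis `{v_n : n ≥ 0} ∪ {w_n : n ≥ 1}`. -/
abbrev BCSpace : Type := BCIndex →₀ ℂ

/-- The fermionic Fock space: the exterior algebra of `V`. -/
abbrev FockF : Type := ExteriorAlgebra ℂ BCSpace

/-- The basis vector of `V` with index `i`. -/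
def bv (i : BCIndex) : BCSpace := Finsupp.single i 1

/-- The linear functional sending the basis vector `i` to `1` and all others to `0`. -/
def bvDual (i : BCIndex) : Module.Dual ℂ BCSpace := Finsupp.lapply i

/-- The operator `b(n)`: for `n ≤ 0` left exterior multiplication by `v_{-n}`,
for `n ≥ 1` contraction with the functional dual to `w_n`. -/
def bOp (n : ℤ) : Module.End ℂ FockF :=
  if n ≤ 0 then LinearMap.mulLeft ℂ (ι ℂ (bv (Sum.inl (-n).toNat)))
  else CliffordAlgebra.contractLeft (bvDual (Sum.inr (n - 1).toNat))

/-- The operator `c(n)`: for `n ≥ 0` contraction with the functional dual to `v_n`,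
for `n ≤ -1` left exterior multiplication by `w_{-n}`. -/
def cOp (n : ℤ) : Module.End ℂ FockF :=
  if 0 ≤ n then CliffordAlgebra.contractLeft (bvDual (Sum.inl n.toNat))
  else LinearMap.mulLeft ℂ (ι ℂ (bv (Sum.inr (-n - 1).toNat)))

/-- The normally ordered product `:b(k)c(j):`. -/
def nbc (k j : ℤ) : Module.End ℂ FockF :=
  if 1 ≤ k ∧ j ≤ -1 then -(cOp j ∘ₗ bOp k) else bOp k ∘ₗ cOp j

/-- The Virasoro modes `L_m` of `T(z) = :∂b(z)c(z):`,
`L_m x = Σ_k (−k)·:b(k)c(m−k):·x` (a finite sum on each `x`). -/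
def Lmode (m : ℤ) (x : FockF) : FockF :=
  ∑ᶠ k : ℤ, (-k : ℂ) • nbc k (m - k) x

/-- The modes `W̃_m` of `W̃(z) = (1/2)(:∂²b(z)c(z): − :∂b(z)∂c(z):)`,
`W̃_m x = (1/2)Σ_k k(2k−m)·:b(k)c(m−k):·x` (a finite sum on each `x`). -/
def Wmode (m : ℤ) (x : FockF) : FockF :=
  ∑ᶠ k : ℤ, ((1 / 2 : ℂ) * k * (2 * k - m)) • nbc k (m - k) x

/-- The charge of a list of basis indices: (number of `v`-type) − (number of `w`-type). -/
def chargeOf (L : List BCIndex) : ℤ :=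
  (L.countP Sum.isLeft : ℤ) - (L.countP Sum.isRight : ℤ)

/-- `F^l`: the span of the wedge monomials of charge `l`. -/
def FF (l : ℤ) : Submodule ℂ FockF :=
  Submodule.span ℂ
    {x | ∃ L : List BCIndex, chargeOf L = l ∧ x = (L.map fun i => ι ℂ (bv i)).prod}

/-- `F̄^l = {x ∈ F^l : c(0)x = 0}`. -/
def FFbar (l : ℤ) : Submodule ℂ FockF := FF l ⊓ LinearMap.ker (cOp 0)

/-- Contraction and exterior multiplication satisfy the canonical anticommutation relation. -/
theorem contractLeft_ι_mul_add (d : Module.Dual ℂ BCSpace) (v : BCSpace) (x : FockF) :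
    CliffordAlgebra.contractLeft d (ι ℂ v * x) + ι ℂ v * CliffordAlgebra.contractLeft d x
      = d v • x := by
  rw [CliffordAlgebra.contractLeft_ι_mul, sub_add_cancel]

theorem ι_mul_ι_mul_add (v w : BCSpace) (x : FockF) :
    ι ℂ v * (ι ℂ w * x) + ι ℂ w * (ι ℂ v * x) = 0 := by
  rw [← mul_assoc, ← mul_assoc, ← add_mul, ExteriorAlgebra.ι_add_mul_swap, zero_mul]

theorem contractLeft_contractLeft_add (d e : Module.Dual ℂ BCSpace) (x : FockF) :
    CliffordAlgebra.contractLeft d (CliffordAlgebra.contractLeft e x)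
      + CliffordAlgebra.contractLeft e (CliffordAlgebra.contractLeft d x) = 0 := by
  rw [CliffordAlgebra.contractLeft_comm, neg_add_cancel]

theorem bvDual_bv (i j : BCIndex) : bvDual i (bv j) = if j = i then 1 else 0 := by
  simp [bvDual, bv, Finsupp.single_apply]

theorem bOp_bOp_add (m n : ℤ) (x : FockF) : bOp m (bOp n x) + bOp n (bOp m x) = 0 := by
  unfold bOp
  split_ifs
  · exact ι_mul_ι_mul_add _ _ x
  · rw [add_comm]
    exact (contractLeft_ι_mul_add _ _ x).trans (by simp [bvDual_bv])
  · exact (contractLeft_ι_mul_add _ _ x).trans (by simp [bvDual_bv])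
  · exact contractLeft_contractLeft_add _ _ x

theorem cOp_cOp_add (m n : ℤ) (x : FockF) : cOp m (cOp n x) + cOp n (cOp m x) = 0 := by
  unfold cOp
  split_ifs
  · exact contractLeft_contractLeft_add _ _ x
  · exact (contractLeft_ι_mul_add _ _ x).trans (by simp [bvDual_bv])
  · rw [add_comm]
    exact (contractLeft_ι_mul_add _ _ x).trans (by simp [bvDual_bv])
  · exact ι_mul_ι_mul_add _ _ x

theorem bOp_cOp_add (m n : ℤ) (x : FockF) :
    bOp m (cOp n x) + cOp n (bOp m x) = if m = -n then x else 0 := by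
  unfold bOp cOp
  split_ifs with hm hn hmn hmn hn hmn hmn
  · rw [add_comm]
    refine (contractLeft_ι_mul_add _ _ x).trans ?_
    rw [bvDual_bv, if_pos (by congr 1; omega), one_smul]
  · rw [add_comm]
    refine (contractLeft_ι_mul_add _ _ x).trans ?_
    rw [bvDual_bv, if_neg (by rw [Sum.inl.injEq]; omega), zero_smul]
  · omega
  · exact ι_mul_ι_mul_add _ _ x
  · omega
  · exact contractLeft_contractLeft_add _ _ x
  · refine (contractLeft_ι_mul_add _ _ x).trans ?_
    rw [bvDual_bv, if_pos (by congr 1; omega), one_smul]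
  · refine (contractLeft_ι_mul_add _ _ x).trans ?_
    rw [bvDual_bv, if_neg (by rw [Sum.inr.injEq]; omega), zero_smul]

/-- Every state is annihilated by all but finitely many contractions. -/
theorem finite_contractLeft_bvDual_ne_zero (x : FockF) :
    {i | CliffordAlgebra.contractLeft (bvDual i) x ≠ 0}.Finite := by
  induction x using CliffordAlgebra.left_induction with
  | algebraMap r => simp [CliffordAlgebra.contractLeft_algebraMap]
  | add x y hx hy =>
    refine (hx.union hy).subset fun i hi => ?_
    by_contra h
    simp only [Set.mem_union, Set.mem_ofPred_eq, not_or, not_not] at h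
    exact hi (by rw [map_add, h.1, h.2, add_zero])
  | ι_mul x v hx =>
    refine (hx.union v.hasFiniteSupport).subset fun i hi => ?_
    by_contra h
    simp only [Set.mem_union, Set.mem_ofPred_eq, not_or, not_not, Function.mem_support] at h
    refine hi ?_
    rw [CliffordAlgebra.contractLeft_ι_mul, h.1, bvDual, Finsupp.lapply_apply, h.2, zero_smul,
      mul_zero, sub_zero]

theorem finite_bOp_ne_zero (x : FockF) : {k : ℤ | 1 ≤ k ∧ bOp k x ≠ 0}.Finite := by
  refine Set.Finite.of_finite_image (f := fun k : ℤ => (Sum.inr (k - 1).toNat : BCIndex))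
    ((finite_contractLeft_bvDual_ne_zero x).subset ?_) ?_
  · rintro _ ⟨k, ⟨hk, hx⟩, rfl⟩
    rwa [bOp, if_neg (by omega)] at hx
  · rintro k ⟨hk, -⟩ l ⟨hl, -⟩ h
    have := Sum.inr.inj h
    omega

theorem finite_cOp_ne_zero (x : FockF) : {k : ℤ | 0 ≤ k ∧ cOp k x ≠ 0}.Finite := by
  refine Set.Finite.of_finite_image (f := fun k : ℤ => (Sum.inl k.toNat : BCIndex))
    ((finite_contractLeft_bvDual_ne_zero x).subset ?_) ?_
  · rintro _ ⟨k, ⟨hk, hx⟩, rfl⟩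
    rwa [cOp, if_pos hk] at hx
  · rintro k ⟨hk, -⟩ l ⟨hl, -⟩ h
    have := Sum.inl.inj h
    omega

theorem finite_nbc_ne_zero (m : ℤ) (x : FockF) : {k : ℤ | nbc k (m - k) x ≠ 0}.Finite := by
  refine ((finite_bOp_ne_zero x).union
    ((finite_cOp_ne_zero x).preimage (f := fun k => m - k) sub_right_injective.injOn)
    |>.union (Set.finite_Icc (m + 1) 0)).subset fun k hk => ?_
  simp only [Set.mem_union, Set.mem_preimage, Set.mem_ofPred_eq, Set.mem_Icc]
  rw [Set.mem_ofPred_eq, nbc] at hk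
  split_ifs at hk with h
  · exact .inl (.inl ⟨h.1, fun h0 => hk (by simp [h0])⟩)
  · by_cases hc : 0 ≤ m - k
    · exact .inl (.inr ⟨hc, fun h0 => hk (by simp [h0])⟩)
    · exact .inr (by omega)

theorem finite_support_Wmode (m : ℤ) (x : FockF) :
    (Function.support fun k : ℤ =>
      ((1 / 2 : ℂ) * k * (2 * k - m)) • nbc k (m - k) x).Finite :=
  (finite_nbc_ne_zero m x).subset fun _ hk h0 => hk (by simp [h0])

theorem nbc_apply (k j : ℤ) (x : FockF) :
    nbc k j x = bOp k (cOp j x) - if 1 ≤ k ∧ k = -j then x else 0 := by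
  have h := bOp_cOp_add k j x
  unfold nbc
  split_ifs at h ⊢ <;> first | omega | simp_all [← eq_sub_iff_add_eq]

theorem nbc_bOp_sub (k j n : ℤ) (x : FockF) :
    nbc k j (bOp n x) - bOp n (nbc k j x) = if n = -j then bOp k x else 0 := by
  have h₁ := congrArg (bOp k) (bOp_cOp_add n j x)
  have h₂ := bOp_bOp_add n k (cOp j x)
  rw [map_add] at h₁
  have h₃ : bOp n (if 1 ≤ k ∧ k = -j then x else 0) = if 1 ≤ k ∧ k = -j then bOp n x else 0 := by
    split_ifs <;> simp
  have h₄ : bOp k (if n = -j then x else 0) = if n = -j then bOp k x else 0 := by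
    split_ifs <;> simp
  rw [nbc_apply, nbc_apply, map_sub, h₃, ← h₄, ← h₁, eq_neg_of_add_eq_zero_left h₂]
  abel

theorem nbc_cOp_sub (k j n : ℤ) (x : FockF) :
    nbc k j (cOp n x) - cOp n (nbc k j x) = if k = -n then -cOp j x else 0 := by
  have h₁ := bOp_cOp_add k n (cOp j x)
  have h₂ := congrArg (bOp k) (cOp_cOp_add j n x)
  rw [map_add, map_zero] at h₂
  have h₃ : cOp n (if 1 ≤ k ∧ k = -j then x else 0) = if 1 ≤ k ∧ k = -j then cOp n x else 0 := by
    split_ifs <;> simp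
  have h₄ : (if k = -n then -cOp j x else 0) = -(if k = -n then cOp j x else 0) := by
    split_ifs <;> simp
  rw [nbc_apply, nbc_apply, map_sub, h₃, h₄, ← h₁, eq_neg_of_add_eq_zero_left h₂]
  abel

/-- The commutator of `W̃_m` with a linear operator can be computed termwise. -/
theorem Wmode_apply_sub (m : ℤ) (T : Module.End ℂ FockF) (x : FockF) :
    Wmode m (T x) - T (Wmode m x) = ∑ᶠ k : ℤ,
      ((1 / 2 : ℂ) * k * (2 * k - m)) • (nbc k (m - k) (T x) - T (nbc k (m - k) x)) := by
  have hx := finite_support_Wmode m x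
  have hT : (Function.support fun k : ℤ =>
      T (((1 / 2 : ℂ) * k * (2 * k - m)) • nbc k (m - k) x)).Finite :=
    hx.subset fun k hk h0 => hk (by simp only [h0, map_zero])
  rw [Wmode, Wmode, map_finsum T hx, ← finsum_sub_distrib (finite_support_Wmode m (T x)) hT]
  simp only [map_smul, smul_sub]

/-- Mode form of the OPEs `W̃(z)b(w) ∼ (1/2)∂b(w)/(z−w)² + ∂²b(w)/(z−w)` and
`W̃(z)c(w) ∼ −c(w)/(z−w)³ − (3/2)∂c(w)/(z−w)² − ∂²c(w)/(z−w)`: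
`[W̃_m, b(n)] = (1/2)(m+n)(m+2n)·b(m+n)` and `[W̃_m, c(n)] = −(1/2)n(m+2n)·c(m+n)`. -/
theorem W_b_c_commutators (m n : ℤ) (x : FockF) :
    Wmode m (bOp n x) - bOp n (Wmode m x)
      = ((1 / 2 : ℂ) * ((m : ℂ) + n) * ((m : ℂ) + 2 * n)) • bOp (m + n) x ∧
    Wmode m (cOp n x) - cOp n (Wmode m x)
      = (-(1 / 2 : ℂ) * (n : ℂ) * ((m : ℂ) + 2 * n)) • cOp (m + n) x := by
  constructor
  · rw [Wmode_apply_sub, finsum_eq_single _ (m + n)]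
    · rw [nbc_bOp_sub, if_pos (by ring)]
      push_cast
      congr 1
      ring
    · intro k hk
      rw [nbc_bOp_sub, if_neg (by omega), smul_zero]
  · rw [Wmode_apply_sub, finsum_eq_single _ (-n)]
    · rw [nbc_cOp_sub, if_pos rfl, sub_neg_eq_add, smul_neg, ← neg_smul]
      push_cast
      congr 1
      ring
    · intro k hk
      rw [nbc_cOp_sub, if_neg hk, smul_zero]
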